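/- For every real a ≥ 1/6, the absolutely convergent series ₃F₂(a, 1/2−3a, 1/2+3a; 3a, 1/2 | 3/4) = ∑_{k≥0} (a)_k (1/2−3a)_k (1/2+3a)_k / ((3a)_k (1/2)_k k!) · (3/4)^k equals 4·√π·Γ(3a)·cos(πa) / (3^{3a}·Γ(2a+1/2)·Γ(a)). -/

import Mathlib

open Polynomial Real
open MeasureTheory Set Filter Topology

/-- A real power series with bounded coefficients can be differentiated termwise on `(-1, 1)`. -/
theorem hasDerivAt_tsum_mul_pow_of_bounded {c : ℕ → ℝ} {M : ℝ} (hc : ∀ k, |c k| ≤ M) {x : ℝ}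
    (hx : |x| < 1) :
    HasDerivAt (fun z : ℝ => ∑' k, c k * z ^ k) (∑' k : ℕ, c k * (k * x ^ (k - 1))) x := by
  obtain ⟨r, hxr, hr1⟩ := exists_between hx
  have hr0 : 0 < r := (abs_nonneg x).trans_lt hxr
  have hM : 0 ≤ M := (abs_nonneg _).trans (hc 0)
  have hu : Summable fun k : ℕ => M * (k * r ^ (k - 1)) := by
    refine Summable.mul_left _ ?_
    have h := summable_pow_mul_geometric_of_norm_lt_one 1
      (show ‖r‖ < 1 by rwa [Real.norm_of_nonneg hr0.le])
    refine (h.mul_left r⁻¹).congr fun k => ?_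
    rcases k with _ | k
    · simp
    · simp only [Nat.add_sub_cancel, pow_succ]
      field_simp
  refine hasDerivAt_tsum_of_isPreconnected (t := Metric.ball (0 : ℝ) r) hu Metric.isOpen_ball
    (convex_ball (0 : ℝ) r).isPreconnected (fun k y _ => (hasDerivAt_pow k y).const_mul (c k))
    (fun k y hy => ?_) (Metric.mem_ball_self hr0) ?_ (by simpa using hxr)
  · rw [mem_ball_zero_iff, Real.norm_eq_abs] at hy
    rw [Real.norm_eq_abs, abs_mul, abs_mul, abs_pow, Nat.abs_cast]
    gcongr
    exact hc k
  · exact summable_of_ne_finset_zero (s := {0}) fun k hk => by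
      simp_all

theorem summable_mul_pow_of_bounded {c : ℕ → ℝ} {M : ℝ} (hc : ∀ k, |c k| ≤ M) {x : ℝ}
    (hx : |x| < 1) : Summable fun k => c k * x ^ k := by
  refine .of_norm_bounded ((summable_geometric_of_lt_one (abs_nonneg x) hx).mul_left M)
    fun k => ?_
  rw [Real.norm_eq_abs, abs_mul, abs_pow]
  gcongr
  exact hc k

theorem hasSum_mul_pow_deriv_of_bounded {c : ℕ → ℝ} {M : ℝ} (hc : ∀ k, |c k| ≤ M) {x : ℝ}
    (hx : |x| < 1) :
    HasSum (fun k : ℕ => c k * (k * x ^ (k - 1))) (∑' k : ℕ, c k * (k * x ^ (k - 1))) := by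
  refine Summable.hasSum ?_
  rw [← summable_nat_add_iff 1]
  have h0 : Summable fun k : ℕ => ((k + 1 : ℕ) : ℝ) * |x| ^ k := by
    have h1 := summable_pow_mul_geometric_of_norm_lt_one 1 (r := |x|) (by simpa using hx)
    have h2 := summable_geometric_of_lt_one (abs_nonneg x) hx
    refine (h1.add h2).congr fun k => ?_
    push_cast
    ring
  refine .of_norm_bounded (h0.mul_left M) fun k => ?_
  rw [Real.norm_eq_abs, abs_mul, abs_mul, abs_pow, Nat.abs_cast]
  simp only [Nat.add_sub_cancel]
  gcongr
  exact hc _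

/-- The coefficients of `₂F₁(1/2 - b, 1/2 + b; 1/2 | z)`. -/
noncomputable def halfCoeff (b : ℝ) (k : ℕ) : ℝ :=
  (ascPochhammer ℝ k).eval (1 / 2 - b) * (ascPochhammer ℝ k).eval (1 / 2 + b) /
    ((ascPochhammer ℝ k).eval (1 / 2 : ℝ) * (Nat.factorial k : ℝ))

theorem halfCoeff_succ (b : ℝ) (k : ℕ) :
    (k + 1) * (k + 1 / 2) * halfCoeff b (k + 1) = ((k + 1 / 2) ^ 2 - b ^ 2) * halfCoeff b k := by
  have h1 : (ascPochhammer ℝ k).eval (1 / 2 : ℝ) ≠ 0 := (ascPochhammer_pos k _ (by norm_num)).ne'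
  have h2 : (Nat.factorial k : ℝ) ≠ 0 := by positivity
  have h3 : (1 / 2 + k : ℝ) ≠ 0 := by positivity
  have h4 : (k + 1 : ℝ) ≠ 0 := by positivity
  simp only [halfCoeff, ascPochhammer_succ_eval, Nat.factorial_succ]
  push_cast
  field_simp
  ring

theorem exists_abs_halfCoeff_le (b : ℝ) : ∃ M, ∀ k, |halfCoeff b k| ≤ M := by
  obtain ⟨N, hN⟩ := exists_nat_ge |b|
  have step : ∀ k, N ≤ k → |halfCoeff b (k + 1)| ≤ |halfCoeff b k| := by
    intro k hk
    have hk' : |b| ≤ k := hN.trans (by exact_mod_cast hk)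
    have hb2 : b ^ 2 ≤ (k : ℝ) ^ 2 :=
      sq_le_sq' (by linarith [neg_abs_le b]) ((le_abs_self b).trans hk')
    have h := congrArg abs (halfCoeff_succ b k)
    have hpos : (0 : ℝ) < (k + 1) * (k + 1 / 2) := by positivity
    have hk0 : (0 : ℝ) ≤ k := by positivity
    have hnn : 0 ≤ ((k : ℝ) + 1 / 2) ^ 2 - b ^ 2 := by nlinarith
    rw [abs_mul, abs_of_pos hpos, abs_mul, abs_of_nonneg hnn] at h
    refine le_of_mul_le_mul_left ?_ hpos
    rw [h]
    refine mul_le_mul_of_nonneg_right ?_ (abs_nonneg _)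
    nlinarith [sq_nonneg b]
  refine ⟨∑ j ∈ Finset.range (N + 1), |halfCoeff b j|, fun k => ?_⟩
  rcases le_total k N with hk | hk
  · exact Finset.single_le_sum (f := fun j => |halfCoeff b j|) (fun j _ => abs_nonneg _)
      (Finset.mem_range.2 (by omega))
  · refine le_trans ?_ (Finset.single_le_sum (f := fun j => |halfCoeff b j|)
      (fun j _ => abs_nonneg _) (Finset.mem_range.2 (Nat.lt_succ_self N)))
    induction k, hk using Nat.le_induction with
    | base => exact le_rfl
    | succ k hk ih => exact (step k hk).trans ih

/-- `cos θ · ₂F₁(1/2 - b, 1/2 + b; 1/2 | sin² θ) = cos (2 b θ)`. -/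
theorem cos_mul_tsum_halfCoeff (b : ℝ) {θ : ℝ} (hθ : θ ∈ Set.Ioo (-(π / 2)) (π / 2)) :
    Real.cos θ * ∑' k, halfCoeff b k * (Real.sin θ ^ 2) ^ k = Real.cos (2 * b * θ) := by
  obtain ⟨M, hM⟩ := exists_abs_halfCoeff_le b
  set c := halfCoeff b with hc
  set e : ℕ → ℝ := fun k => c k / (2 * k + 1) with he
  have hM' : ∀ k, |e k| ≤ M := fun k => by
    rw [he, abs_div, abs_of_pos (by positivity : (0 : ℝ) < 2 * k + 1)]
    refine (div_le_self (abs_nonneg _) ?_).trans (hM k)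
    have : (0 : ℝ) ≤ k := by positivity
    linarith
  set f : ℝ → ℝ := fun z => ∑' k, c k * z ^ k with hf
  set p : ℝ → ℝ := fun z => ∑' k, e k * z ^ k with hp
  set f' : ℝ → ℝ := fun z => ∑' k : ℕ, c k * (k * z ^ (k - 1)) with hf'
  set p' : ℝ → ℝ := fun z => ∑' k : ℕ, e k * (k * z ^ (k - 1)) with hp'
  have mul_shift : ∀ (d : ℕ → ℝ) (z s : ℝ), HasSum (fun k : ℕ => d k * (k * z ^ (k - 1))) s →
      HasSum (fun k : ℕ => d k * k * z ^ k) (z * s) := fun d z s h => by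
    refine (h.mul_left z).congr_fun fun k => ?_
    rcases k with _ | k
    · simp
    · simp only [Nat.add_sub_cancel, pow_succ]
      ring
  have eq_p : ∀ z, |z| < 1 → p z + 2 * (z * p' z) = f z := by
    intro z hz
    have h1 := (summable_mul_pow_of_bounded hM' hz).hasSum
    have h2 := mul_shift _ _ _ (hasSum_mul_pow_deriv_of_bounded hM' hz)
    refine HasSum.unique (h1.add (h2.mul_left 2)) ?_
    refine (summable_mul_pow_of_bounded hM hz).hasSum.congr_fun fun k => ?_
    have : (2 * k + 1 : ℝ) ≠ 0 := by positivity
    simp only [he]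
    field_simp
    ring
  have eq_f : ∀ z, |z| < 1 → 2 * (1 - z) * f' z - f z = -(4 * b ^ 2) * p z := by
    intro z hz
    have h0 := (summable_mul_pow_of_bounded hM hz).hasSum
    have h1 := hasSum_mul_pow_deriv_of_bounded hM hz
    have h2 := mul_shift _ _ _ h1
    have h3 := (hasSum_nat_add_iff' 1).2 h1
    simp only [Finset.range_one, Finset.sum_singleton, Nat.cast_zero, zero_mul, mul_zero,
      sub_zero, Nat.add_sub_cancel] at h3
    have h4 := (summable_mul_pow_of_bounded hM' hz).hasSum
    have h5 := ((h3.mul_left 2).sub (h2.mul_left 2)).sub h0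
    have : 2 * (1 - z) * f' z - f z = 2 * f' z - 2 * (z * f' z) - f z := by ring
    rw [this]
    refine HasSum.unique h5 ((h4.mul_left (-(4 * b ^ 2))).congr_fun fun k => ?_)
    have hk : (2 * k + 1 : ℝ) ≠ 0 := by positivity
    have hs := halfCoeff_succ b k
    rw [← hc] at hs
    have hs' : 2 * (k + 1) * c (k + 1) = ((2 * k + 1) - 4 * b ^ 2 / (2 * k + 1)) * c k := by
      field_simp
      linear_combination 4 * hs
    simp only [he]
    push_cast
    have : c k / (2 * k + 1) * (4 * b ^ 2) = 4 * b ^ 2 / (2 * k + 1) * c k := by ring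
    linear_combination z ^ k * hs' + z ^ k * this
  have sin_lt : ∀ y ∈ Set.Ioo (-(π / 2)) (π / 2), |Real.sin y ^ 2| < 1 := fun y hy => by
    have := Real.cos_pos_of_mem_Ioo hy
    rw [abs_of_nonneg (sq_nonneg _)]
    nlinarith [Real.sin_sq_add_cos_sq y]
  set g : ℝ → ℝ := fun y => Real.cos y * f (Real.sin y ^ 2) with hg
  set h : ℝ → ℝ := fun y => 2 * b * (Real.sin y * p (Real.sin y ^ 2)) with hh
  have sq_deriv : ∀ y, HasDerivAt (fun y => Real.sin y ^ 2) (2 * Real.sin y * Real.cos y) y :=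
    fun y => by simpa using (Real.hasDerivAt_sin y).fun_pow 2
  have hg' : ∀ y ∈ Set.Ioo (-(π / 2)) (π / 2), HasDerivAt g (-(2 * b) * h y) y := by
    intro y hy
    have hd := (Real.hasDerivAt_cos y).mul
      ((hasDerivAt_tsum_mul_pow_of_bounded hM (sin_lt y hy)).comp y (sq_deriv y))
    refine hd.congr_deriv ?_
    have h1 := eq_f _ (sin_lt y hy)
    have h2 : 1 - Real.sin y ^ 2 = Real.cos y ^ 2 := by linarith [Real.sin_sq_add_cos_sq y]
    rw [h2] at h1
    simp only [hh]
    change -Real.sin y * f (Real.sin y ^ 2) +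
      Real.cos y * (f' (Real.sin y ^ 2) * (2 * Real.sin y * Real.cos y)) = _
    linear_combination Real.sin y * h1
  have hh' : ∀ y ∈ Set.Ioo (-(π / 2)) (π / 2), HasDerivAt h (2 * b * g y) y := by
    intro y hy
    have hd := ((Real.hasDerivAt_sin y).mul
      ((hasDerivAt_tsum_mul_pow_of_bounded hM' (sin_lt y hy)).comp y (sq_deriv y))).const_mul
        (2 * b)
    refine hd.congr_deriv ?_
    have h1 := eq_p _ (sin_lt y hy)
    simp only [hg]
    change 2 * b * (Real.cos y * p (Real.sin y ^ 2) +
      Real.sin y * (p' (Real.sin y ^ 2) * (2 * Real.sin y * Real.cos y))) = _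
    linear_combination 2 * b * Real.cos y * h1
  set E : ℝ → ℝ := fun y => (g y - Real.cos (2 * b * y)) ^ 2 + (h y - Real.sin (2 * b * y)) ^ 2
    with hE
  have hlin : ∀ y : ℝ, HasDerivAt (fun y => 2 * b * y) (2 * b) y := fun y => by
    simpa using (hasDerivAt_id y).const_mul (2 * b)
  have hE' : ∀ y ∈ Set.Ioo (-(π / 2)) (π / 2), HasDerivAt E 0 y := by
    intro y hy
    have h1 := ((hg' y hy).sub (hlin y).cos).pow 2
    have h2 := ((hh' y hy).sub (hlin y).sin).pow 2
    refine (h1.add h2).congr_deriv ?_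
    simp only [Pi.sub_apply, Nat.cast_ofNat, Nat.add_one_sub_one, pow_one]
    ring
  have h0mem : (0 : ℝ) ∈ Set.Ioo (-(π / 2)) (π / 2) := by constructor <;> linarith [Real.pi_pos]
  have hconst : E θ = E 0 :=
    isOpen_Ioo.is_const_of_deriv_eq_zero isPreconnected_Ioo
      (fun y hy => (hE' y hy).differentiableAt.differentiableWithinAt)
      (fun y hy => (hE' y hy).deriv) hθ h0mem
  have hf0 : f 0 = 1 := by
    simp only [hf]
    rw [tsum_eq_single 0 (fun k hk => by simp [hk])]
    simp [hc, halfCoeff]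
  have hE0 : E 0 = 0 := by simp [hE, hg, hh, hf0]
  rw [hE0] at hconst
  have : g θ - Real.cos (2 * b * θ) = 0 := by
    simp only [hE] at hconst
    nlinarith [sq_nonneg (g θ - Real.cos (2 * b * θ)), sq_nonneg (h θ - Real.sin (2 * b * θ))]
  exact sub_eq_zero.1 this

theorem ofReal_rpow_mul_one_sub_rpow (u v : ℝ) {t : ℝ} (ht : t ∈ Ioo (0 : ℝ) 1) :
    ((t ^ (u - 1) * (1 - t) ^ (v - 1) : ℝ) : ℂ) =
      (t : ℂ) ^ ((u : ℂ) - 1) * (1 - (t : ℂ)) ^ ((v : ℂ) - 1) := by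
  rw [Complex.ofReal_mul, Complex.ofReal_cpow ht.1.le, Complex.ofReal_cpow (sub_nonneg.2 ht.2.le)]
  push_cast
  rfl

theorem integrableOn_rpow_mul_one_sub_rpow {u v : ℝ} (hu : 0 < u) (hv : 0 < v) :
    IntegrableOn (fun t : ℝ => t ^ (u - 1) * (1 - t) ^ (v - 1)) (Ioo 0 1) := by
  have h := Complex.betaIntegral_convergent (u := u) (v := v) (by simpa) (by simpa)
  rw [intervalIntegrable_iff_integrableOn_Ioo_of_le zero_le_one] at h
  refine IntegrableOn.congr_fun h.re (fun t ht => ?_) measurableSet_Ioo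
  change ((t : ℂ) ^ ((u : ℂ) - 1) * (1 - (t : ℂ)) ^ ((v : ℂ) - 1)).re = _
  rw [← ofReal_rpow_mul_one_sub_rpow u v ht, Complex.ofReal_re]

theorem integral_rpow_mul_one_sub_rpow {u v : ℝ} (hu : 0 < u) (hv : 0 < v) :
    ∫ t in Ioo (0 : ℝ) 1, t ^ (u - 1) * (1 - t) ^ (v - 1) =
      Real.Gamma u * Real.Gamma v / Real.Gamma (u + v) := by
  have h := ProbabilityTheory.beta_eq_betaIntegralReal u v hu hv
  rw [ProbabilityTheory.beta, Complex.betaIntegral,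
    intervalIntegral.integral_of_le zero_le_one, integral_Ioc_eq_integral_Ioo] at h
  rw [h, ← setIntegral_congr_fun measurableSet_Ioo
    (fun t ht => ofReal_rpow_mul_one_sub_rpow u v ht), integral_complex_ofReal]
  exact (Complex.ofReal_re _).symm

theorem integral_exp_add_half_mul_I (k : ℕ) :
    ∫ ψ in (-π)..π, Complex.exp ((k + 1 / 2) * ψ * Complex.I) =
      2 * (-1) ^ k / ((k : ℂ) + 1 / 2) := by
  have hk : ((k : ℂ) + 1 / 2) ≠ 0 := by
    have h : ((k : ℝ) + 1 / 2 : ℝ) ≠ 0 := by positivity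
    have := Complex.ofReal_ne_zero.2 h
    push_cast at this
    exact this
  have h := integral_exp_mul_complex (a := -π) (b := π)
    (mul_ne_zero hk Complex.I_ne_zero)
  have e1 : Complex.exp (((k : ℂ) + 1 / 2) * Complex.I * (π : ℝ)) = (-1) ^ k * Complex.I := by
    rw [show ((k : ℂ) + 1 / 2) * Complex.I * (π : ℝ) =
      k * (π * Complex.I) + π / 2 * Complex.I by ring, Complex.exp_add, Complex.exp_nat_mul,
      Complex.exp_pi_mul_I, Complex.exp_pi_div_two_mul_I]
  have e2 : Complex.exp (((k : ℂ) + 1 / 2) * Complex.I * ((-π : ℝ) : ℂ)) =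
      -((-1) ^ k * Complex.I) := by
    rw [Complex.ofReal_neg, mul_neg, Complex.exp_neg, e1, mul_inv, Complex.inv_I, ← inv_pow]
    norm_num
  rw [e1, e2] at h
  have h' : ∫ ψ in (-π)..π, Complex.exp ((k + 1 / 2) * ψ * Complex.I) =
      ∫ ψ in (-π)..π, Complex.exp ((k + 1 / 2) * Complex.I * ψ) := by
    congr 1 with ψ
    ring_nf
  rw [h', h]
  field_simp [Complex.I_ne_zero]
  ring

/-- For `F` analytic in the unit disc, the integral of `F (r e^{iψ}) e^{iψ/2}` over a circle of
radius `r < 1` collapses onto the radius `(-r, 0)`. -/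
theorem integral_circle_half_eq_integral_radius {F : ℂ → ℂ} {f : ℕ → ℂ}
    (hF : ∀ z : ℂ, ‖z‖ < 1 → HasSum (fun k => f k * z ^ k) (F z)) {r : ℝ} (hr0 : 0 ≤ r)
    (hr1 : r < 1) :
    ∫ ψ in Ioo (-π) π, F (r * Complex.exp (ψ * Complex.I)) * Complex.exp (ψ / 2 * Complex.I) =
      2 * ∫ t in Ioo (0 : ℝ) 1, ((t ^ (1 / 2 - 1 : ℝ) : ℝ) : ℂ) * F (-(r * t)) := by
  have hsum : Summable fun k => ‖f k‖ * r ^ k := by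
    have := (hF r (by rwa [Complex.norm_real, Real.norm_of_nonneg hr0])).summable.norm
    simpa [abs_of_nonneg hr0] using this
  have hpi : -π ≤ π := by linarith [Real.pi_pos]
  have h1 : HasSum (fun k : ℕ => f k * r ^ k * (2 * (-1) ^ k / ((k : ℂ) + 1 / 2)))
      (∫ ψ in Ioo (-π) π, F (r * Complex.exp (ψ * Complex.I)) *
        Complex.exp (ψ / 2 * Complex.I)) := by
    have h := hasSum_integral_of_summable_integral_norm (μ := volume.restrict (Ioo (-π) π))
      (F := fun (k : ℕ) (ψ : ℝ) => f k * r ^ k * Complex.exp ((k + 1 / 2) * ψ * Complex.I))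
      (fun k => ?_) ?_
    · convert! h using 1
      · ext k
        rw [integral_const_mul, ← integral_Ioc_eq_integral_Ioo,
          ← intervalIntegral.integral_of_le hpi, integral_exp_add_half_mul_I]
      · refine integral_congr_ae (Eventually.of_forall fun ψ => ?_)
        have hz : ‖(r : ℂ) * Complex.exp (ψ * Complex.I)‖ < 1 := by
          rw [norm_mul, Complex.norm_exp_ofReal_mul_I, Complex.norm_real,
            Real.norm_of_nonneg hr0, mul_one]
          exact hr1
        beta_reduce
        rw [← ((hF _ hz).mul_right (Complex.exp (ψ / 2 * Complex.I))).tsum_eq]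
        refine tsum_congr fun k => ?_
        rw [mul_pow, ← Complex.exp_nat_mul, mul_assoc, mul_assoc, ← Complex.exp_add, mul_assoc]
        ring_nf
    · exact ((Continuous.integrableOn_Icc (by fun_prop)).mono_set Ioo_subset_Icc_self)
    · have hn : ∀ (k : ℕ) (ψ : ℝ), ‖f k * r ^ k * Complex.exp ((k + 1 / 2) * ψ * Complex.I)‖ =
          ‖f k‖ * r ^ k := fun k ψ => by
        rw [norm_mul, show ((k : ℂ) + 1 / 2) * ψ = (((k : ℝ) + 1 / 2) * ψ : ℝ) by push_cast; ring,
          Complex.norm_exp_ofReal_mul_I]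
        simp [abs_of_nonneg hr0]
      simp only [hn, integral_const]
      exact hsum.const_smul _
  have h2 : HasSum (fun k : ℕ => f k * (-r) ^ k * (1 / ((k : ℂ) + 1 / 2)))
      (∫ t in Ioo (0 : ℝ) 1, ((t ^ (1 / 2 - 1 : ℝ) : ℝ) : ℂ) * F (-(r * t))) := by
    have hkint : ∀ k : ℕ, IntegrableOn (fun t : ℝ => t ^ ((k : ℝ) + 1 / 2 - 1)) (Ioo 0 1) :=
      fun k => by
        have := integrableOn_rpow_mul_one_sub_rpow (u := k + 1 / 2) (v := 1) (by positivity)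
          one_pos
        simpa using this
    have hkval : ∀ k : ℕ, ∫ t in Ioo (0 : ℝ) 1, t ^ ((k : ℝ) + 1 / 2 - 1) =
        1 / ((k : ℝ) + 1 / 2) := fun k => by
      have hk : (0 : ℝ) < k + 1 / 2 := by positivity
      rw [← integral_Ioc_eq_integral_Ioo, ← intervalIntegral.integral_of_le zero_le_one,
        integral_rpow (Or.inl (by linarith)), sub_add_cancel, Real.one_rpow,
        Real.zero_rpow hk.ne', sub_zero]
    have h := hasSum_integral_of_summable_integral_norm (μ := volume.restrict (Ioo (0 : ℝ) 1))
      (F := fun (k : ℕ) (t : ℝ) => f k * (-r) ^ k * ((t ^ ((k : ℝ) + 1 / 2 - 1) : ℝ) : ℂ))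
      (fun k => ?_) ?_
    · convert! h using 1
      · ext k
        rw [integral_const_mul, integral_complex_ofReal, hkval]
        push_cast
        rfl
      · refine setIntegral_congr_fun measurableSet_Ioo fun t ht => ?_
        have hz : ‖-((r : ℂ) * t)‖ < 1 := by
          rw [norm_neg, norm_mul, Complex.norm_real, Complex.norm_real,
            Real.norm_of_nonneg hr0, Real.norm_of_nonneg ht.1.le]
          nlinarith [ht.1, ht.2]
        rw [← ((hF _ hz).mul_left _).tsum_eq]
        refine tsum_congr fun k => ?_
        rw [add_sub_assoc, Real.rpow_add ht.1, Real.rpow_natCast, ← neg_mul, mul_pow]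
        push_cast
        ring
    · exact (hkint k).ofReal.const_mul _
    · have hn : ∀ k : ℕ, ∫ t in Ioo (0 : ℝ) 1,
          ‖f k * (-r) ^ k * ((t ^ ((k : ℝ) + 1 / 2 - 1) : ℝ) : ℂ)‖ =
          ‖f k‖ * r ^ k * (1 / ((k : ℝ) + 1 / 2)) := fun k => by
        rw [← hkval, ← integral_const_mul]
        refine setIntegral_congr_fun measurableSet_Ioo fun t ht => ?_
        simp [abs_of_nonneg hr0, abs_of_nonneg (Real.rpow_nonneg ht.1.le _)]
      simp only [hn]
      refine (hsum.mul_left 2).of_nonneg_of_le (fun k => by positivity) fun k => ?_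
      rw [mul_comm]
      gcongr
      rw [div_le_iff₀ (by positivity)]
      have : (0 : ℝ) ≤ k := by positivity
      linarith
  refine h1.unique ((h2.mul_left 2).congr_fun fun k => ?_)
  rw [neg_pow]
  ring

theorem hasSum_one_add_cpow (α : ℂ) {z : ℂ} (hz : ‖z‖ < 1) :
    HasSum (fun k => Ring.choose α k * z ^ k) ((1 + z) ^ α) := by
  have h := (Complex.one_add_cpow_hasFPowerSeriesOnBall_zero (a := α)).hasSum (y := z)
    (by rwa [Metric.mem_eball, edist_zero_right, ← ofReal_norm, ENNReal.ofReal_lt_one])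
  rw [zero_add] at h
  refine h.congr_fun fun k => ?_
  rw [binomialSeries_apply, List.ofFn_const, List.prod_replicate, smul_eq_mul]

theorem one_add_mul_cos_pos {r ψ : ℝ} (hr0 : 0 ≤ r) (hr1 : r ≤ 1) (hψ : ψ ∈ Ioo (-π) π) :
    0 < 1 + r * Real.cos ψ := by
  have h1 : Real.cos ψ = 2 * Real.cos (ψ / 2) ^ 2 - 1 := by
    rw [← Real.cos_two_mul]; ring_nf
  have h2 : 0 < Real.cos (ψ / 2) :=
    Real.cos_pos_of_mem_Ioo ⟨by linarith [hψ.1], by linarith [hψ.2]⟩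
  rw [h1]
  rcases hr0.eq_or_lt with rfl | hr
  · norm_num
  · have := mul_pos hr (pow_pos h2 2)
    linarith

theorem one_add_mul_exp_mem_slitPlane {r ψ : ℝ} (hr0 : 0 ≤ r) (hr1 : r ≤ 1)
    (hψ : ψ ∈ Ioo (-π) π) : 1 + (r : ℂ) * Complex.exp (ψ * Complex.I) ∈ Complex.slitPlane := by
  refine Or.inl ?_
  have := one_add_mul_cos_pos hr0 hr1 hψ
  simpa [Complex.exp_ofReal_mul_I_re] using this

theorem norm_one_add_mul_exp_sq (r ψ : ℝ) :
    ‖1 + (r : ℂ) * Complex.exp (ψ * Complex.I)‖ ^ 2 =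
      (1 - r) ^ 2 + 4 * r * Real.cos (ψ / 2) ^ 2 := by
  have h1 : Real.cos ψ = 2 * Real.cos (ψ / 2) ^ 2 - 1 := by
    rw [← Real.cos_two_mul]; ring_nf
  rw [← Complex.normSq_eq_norm_sq, Complex.normSq_apply]
  simp only [Complex.add_re, Complex.one_re, Complex.re_ofReal_mul, Complex.exp_ofReal_mul_I_re,
    Complex.add_im, Complex.one_im, Complex.im_ofReal_mul, Complex.exp_ofReal_mul_I_im]
  linear_combination r ^ 2 * Real.sin_sq_add_cos_sq ψ + 2 * r * h1

/-- An integrable bound, uniform in `r`, for `|1 + r e^{iψ}| ^ (s - 1)`. -/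
theorem norm_one_add_mul_exp_rpow_le (s : ℝ) {r ψ : ℝ} (hr0 : 1 / 4 ≤ r)
    (hr1 : r ≤ 1) (hψ : ψ ∈ Ioo (-π) π) :
    ‖1 + (r : ℂ) * Complex.exp (ψ * Complex.I)‖ ^ (s - 1) ≤
      2 ^ (s - 1) + ((π - ψ) ^ (s - 1) / π ^ (s - 1) + (ψ - -π) ^ (s - 1) / π ^ (s - 1)) := by
  have hπ := Real.pi_pos
  have hA : 0 < π - ψ := by linarith [hψ.2]
  have hB : 0 < ψ - -π := by linarith [hψ.1]
  have hA' : 0 ≤ (π - ψ) ^ (s - 1) / π ^ (s - 1) := by positivity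
  have hB' : 0 ≤ (ψ - -π) ^ (s - 1) / π ^ (s - 1) := by positivity
  have h2 : (0 : ℝ) ≤ 2 ^ (s - 1) := by positivity
  rcases le_total 1 s with hs | hs
  · have : ‖1 + (r : ℂ) * Complex.exp (ψ * Complex.I)‖ ^ (s - 1) ≤ 2 ^ (s - 1) := by
      refine Real.rpow_le_rpow (norm_nonneg _) ?_ (by linarith)
      refine (norm_add_le _ _).trans ?_
      rw [norm_mul, Complex.norm_exp_ofReal_mul_I, Complex.norm_real,
        Real.norm_of_nonneg (by linarith), norm_one]
      linarith
    linarith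
  · have hcos : 0 < Real.cos (ψ / 2) :=
      Real.cos_pos_of_mem_Ioo ⟨by linarith [hψ.1], by linarith [hψ.2]⟩
    have hn : Real.cos (ψ / 2) ≤ ‖1 + (r : ℂ) * Complex.exp (ψ * Complex.I)‖ := by
      refine le_of_sq_le_sq ?_ (norm_nonneg _)
      rw [norm_one_add_mul_exp_sq]
      nlinarith [sq_nonneg (1 - r), sq_nonneg (Real.cos (ψ / 2))]
    have key : ∀ d : ℝ, 0 < d → d / π ≤ Real.cos (ψ / 2) →
        ‖1 + (r : ℂ) * Complex.exp (ψ * Complex.I)‖ ^ (s - 1) ≤ d ^ (s - 1) / π ^ (s - 1) :=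
      fun d hd hdc => by
        rw [← Real.div_rpow hd.le hπ.le]
        exact Real.rpow_le_rpow_of_nonpos (by positivity) (hdc.trans hn) (by linarith)
    rcases le_total 0 ψ with h0 | h0
    · have := key _ hA (by
        have := Real.one_sub_mul_le_cos (x := ψ / 2) (by linarith) (by linarith [hψ.2])
        refine le_trans (le_of_eq ?_) this
        field_simp)
      linarith
    · have := key _ hB (by
        have := Real.one_add_mul_le_cos (x := ψ / 2) (by linarith [hψ.1]) (by linarith)
        refine le_trans (le_of_eq ?_) this
        field_simp
        ring)
      linarith

theorem integrableOn_norm_one_add_mul_exp_bound {s : ℝ} (hs : 0 < s) :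
    IntegrableOn (fun ψ : ℝ => (2 : ℝ) ^ (s - 1) +
      ((π - ψ) ^ (s - 1) / π ^ (s - 1) + (ψ - -π) ^ (s - 1) / π ^ (s - 1))) (Ioo (-π) π) := by
  have hpi : -π ≤ π := by linarith [Real.pi_pos]
  have h := intervalIntegral.intervalIntegrable_rpow' (a := 0) (b := 2 * π)
    (show -1 < s - 1 by linarith)
  have h1 := (h.comp_sub_left π).symm
  have h2 := h.comp_sub_right (-π)
  rw [show π - 2 * π = -π by ring, sub_zero] at h1
  rw [show 2 * π + -π = π by ring, zero_add] at h2
  rw [← intervalIntegrable_iff_integrableOn_Ioo_of_le hpi]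
  exact intervalIntegrable_const.add ((h1.div_const _).add (h2.div_const _))

theorem one_add_exp_cpow_mul_exp (s : ℝ) {ψ : ℝ} (hψ : ψ ∈ Ioo (-π) π) :
    (1 + ((1 : ℝ) : ℂ) * Complex.exp (ψ * Complex.I)) ^ ((s - 1 : ℝ) : ℂ) *
        Complex.exp (ψ / 2 * Complex.I) =
      (((2 * Real.cos (ψ / 2)) ^ (s - 1) : ℝ) : ℂ) * Complex.exp (s * ψ / 2 * Complex.I) := by
  have hcos : 0 < 2 * Real.cos (ψ / 2) :=
    mul_pos two_pos (Real.cos_pos_of_mem_Ioo ⟨by linarith [hψ.1], by linarith [hψ.2]⟩)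
  have hw : 1 + ((1 : ℝ) : ℂ) * Complex.exp (ψ * Complex.I) =
      ((2 * Real.cos (ψ / 2) : ℝ) : ℂ) * Complex.exp (ψ / 2 * Complex.I) := by
    have e : Complex.exp (ψ * Complex.I) =
        Complex.exp (ψ / 2 * Complex.I) * Complex.exp (ψ / 2 * Complex.I) := by
      rw [← Complex.exp_add]; ring_nf
    have e' : Complex.exp (-(ψ / 2) * Complex.I) * Complex.exp (ψ / 2 * Complex.I) = 1 := by
      rw [← Complex.exp_add]; simp
    push_cast
    rw [Complex.two_cos, e]
    linear_combination -e'
  have hne : 1 + ((1 : ℝ) : ℂ) * Complex.exp (ψ * Complex.I) ≠ 0 :=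
    Complex.slitPlane_ne_zero (one_add_mul_exp_mem_slitPlane zero_le_one le_rfl hψ)
  have him : ((ψ : ℂ) / 2 * Complex.I).im = ψ / 2 := by
    rw [show (ψ : ℂ) / 2 = ((ψ / 2 : ℝ) : ℂ) by push_cast; rfl, Complex.im_ofReal_mul,
      Complex.I_im, mul_one]
  have hlog : Complex.log (1 + ((1 : ℝ) : ℂ) * Complex.exp (ψ * Complex.I)) =
      Real.log (2 * Real.cos (ψ / 2)) + ψ / 2 * Complex.I := by
    rw [hw, Complex.log_ofReal_mul hcos (Complex.exp_ne_zero _), Complex.log_exp]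
    · rw [him]; linarith [hψ.1, Real.pi_pos]
    · rw [him]; linarith [hψ.2, Real.pi_pos]
  rw [Complex.cpow_def_of_ne_zero hne, hlog, Real.rpow_def_of_pos hcos, Complex.ofReal_exp,
    ← Complex.exp_add, ← Complex.exp_add]
  congr 1
  push_cast
  ring

theorem integrableOn_two_mul_cos_rpow_mul_exp {s : ℝ} (hs : 0 < s) :
    IntegrableOn (fun ψ : ℝ => (((2 * Real.cos (ψ / 2)) ^ (s - 1) : ℝ) : ℂ) *
      Complex.exp (s * ψ / 2 * Complex.I)) (Ioo (-π) π) := by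
  refine Integrable.mono' (integrableOn_norm_one_add_mul_exp_bound hs) ?_ ?_
  · refine Measurable.aestronglyMeasurable ?_
    fun_prop
  · refine (ae_restrict_iff' measurableSet_Ioo).2 (Eventually.of_forall fun ψ hψ => ?_)
    rw [← one_add_exp_cpow_mul_exp s hψ, norm_mul, Complex.norm_cpow_real,
      show (ψ : ℂ) / 2 = ((ψ / 2 : ℝ) : ℂ) by push_cast; rfl, Complex.norm_exp_ofReal_mul_I,
      mul_one]
    exact norm_one_add_mul_exp_rpow_le s (by norm_num) le_rfl hψ

theorem integral_two_mul_cos_rpow_mul_exp {s : ℝ} (hs : 0 < s) :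
    ∫ ψ in Ioo (-π) π, (((2 * Real.cos (ψ / 2)) ^ (s - 1) : ℝ) : ℂ) *
        Complex.exp (s * ψ / 2 * Complex.I) =
      ((2 * (Real.Gamma (1 / 2) * Real.Gamma s / Real.Gamma (1 / 2 + s)) : ℝ) : ℂ) := by
  have hev : ∀ᶠ r : ℝ in 𝓝[<] 1, 1 / 4 < r ∧ r < 1 := by
    have h1 : ∀ᶠ r : ℝ in 𝓝[<] 1, 1 / 4 < r :=
      nhdsWithin_le_nhds (lt_mem_nhds (by norm_num))
    exact h1.and self_mem_nhdsWithin
  have hleft : Tendsto (fun r : ℝ => ∫ ψ in Ioo (-π) π,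
      (1 + (r : ℂ) * Complex.exp (ψ * Complex.I)) ^ ((s - 1 : ℝ) : ℂ) *
        Complex.exp (ψ / 2 * Complex.I)) (𝓝[<] 1)
      (𝓝 (∫ ψ in Ioo (-π) π, (((2 * Real.cos (ψ / 2)) ^ (s - 1) : ℝ) : ℂ) *
        Complex.exp (s * ψ / 2 * Complex.I))) := by
    refine tendsto_integral_filter_of_dominated_convergence _ ?_ ?_
      (integrableOn_norm_one_add_mul_exp_bound hs) ?_
    · refine Eventually.of_forall fun r => Measurable.aestronglyMeasurable ?_
      fun_prop
    · filter_upwards [hev] with r hr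
      refine (ae_restrict_iff' measurableSet_Ioo).2 (Eventually.of_forall fun ψ hψ => ?_)
      rw [norm_mul, Complex.norm_cpow_real,
        show (ψ : ℂ) / 2 = ((ψ / 2 : ℝ) : ℂ) by push_cast; rfl, Complex.norm_exp_ofReal_mul_I,
        mul_one]
      exact norm_one_add_mul_exp_rpow_le s hr.1.le hr.2.le hψ
    · refine (ae_restrict_iff' measurableSet_Ioo).2 (Eventually.of_forall fun ψ hψ => ?_)
      rw [← one_add_exp_cpow_mul_exp s hψ]
      refine Tendsto.mul_const _ (tendsto_nhdsWithin_of_tendsto_nhds ?_)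
      have hc : ContinuousAt (fun r : ℝ => 1 + (r : ℂ) * Complex.exp (ψ * Complex.I)) 1 := by
        fun_prop
      exact (hc.cpow continuousAt_const
        (one_add_mul_exp_mem_slitPlane zero_le_one le_rfl hψ)).tendsto
  have hright : Tendsto (fun r : ℝ => ∫ t in Ioo (0 : ℝ) 1,
      t ^ (1 / 2 - 1 : ℝ) * (1 - r * t) ^ (s - 1)) (𝓝[<] 1)
      (𝓝 (∫ t in Ioo (0 : ℝ) 1, t ^ (1 / 2 - 1 : ℝ) * (1 - t) ^ (s - 1))) := by
    refine tendsto_integral_filter_of_dominated_convergence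
      (fun t => t ^ (1 / 2 - 1 : ℝ) * (1 - t) ^ (1 - 1 : ℝ) +
        t ^ (1 / 2 - 1 : ℝ) * (1 - t) ^ (s - 1)) ?_ ?_
      ((integrableOn_rpow_mul_one_sub_rpow (by norm_num) one_pos).add
        (integrableOn_rpow_mul_one_sub_rpow (by norm_num) hs)) ?_
    · refine Eventually.of_forall fun r => Measurable.aestronglyMeasurable ?_
      fun_prop
    · filter_upwards [hev] with r hr
      refine (ae_restrict_iff' measurableSet_Ioo).2 (Eventually.of_forall fun t ht => ?_)
      have h1 : 0 < 1 - t := by linarith [ht.2]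
      have h2 : 1 - t ≤ 1 - r * t := by nlinarith [ht.1, hr.2]
      have h3 : 1 - r * t ≤ 1 := by nlinarith [ht.1, hr.1]
      have h4 : 0 < 1 - r * t := h1.trans_le h2
      have ht0 : 0 ≤ t ^ (1 / 2 - 1 : ℝ) := Real.rpow_nonneg ht.1.le _
      rw [Real.norm_of_nonneg (mul_nonneg ht0 (Real.rpow_nonneg h4.le _)), ← mul_add]
      refine mul_le_mul_of_nonneg_left ?_ ht0
      rw [sub_self, Real.rpow_zero]
      have h5 := Real.rpow_nonneg h1.le (s - 1)
      rcases le_total 1 s with hs1 | hs1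
      · linarith [Real.rpow_le_one h4.le h3 (show 0 ≤ s - 1 by linarith)]
      · linarith [Real.rpow_le_rpow_of_nonpos h1 h2 (show s - 1 ≤ 0 by linarith)]
    · refine (ae_restrict_iff' measurableSet_Ioo).2 (Eventually.of_forall fun t ht => ?_)
      refine Tendsto.const_mul _ (tendsto_nhdsWithin_of_tendsto_nhds ?_)
      have h1 : (1 - 1 * t) ≠ 0 := by linarith [ht.2]
      have hc : ContinuousAt (fun r : ℝ => (1 - r * t) ^ (s - 1)) 1 :=
        ContinuousAt.rpow_const (by fun_prop) (Or.inl h1)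
      simpa using hc.tendsto
  have heq : ∀ᶠ r : ℝ in 𝓝[<] 1, ∫ ψ in Ioo (-π) π,
      (1 + (r : ℂ) * Complex.exp (ψ * Complex.I)) ^ ((s - 1 : ℝ) : ℂ) *
        Complex.exp (ψ / 2 * Complex.I) =
      ((2 * ∫ t in Ioo (0 : ℝ) 1, t ^ (1 / 2 - 1 : ℝ) * (1 - r * t) ^ (s - 1) : ℝ) : ℂ) := by
    filter_upwards [hev] with r hr
    have h := integral_circle_half_eq_integral_radius
      (F := fun z => (1 + z) ^ ((s - 1 : ℝ) : ℂ)) (fun z hz => hasSum_one_add_cpow _ hz)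
      (show 0 ≤ r by linarith [hr.1]) hr.2
    rw [h, Complex.ofReal_mul, Complex.ofReal_ofNat, ← integral_complex_ofReal]
    congr 1
    refine setIntegral_congr_fun measurableSet_Ioo fun t ht => ?_
    have h4 : 0 ≤ 1 - r * t := by nlinarith [ht.1, ht.2, hr.1, hr.2]
    rw [Complex.ofReal_mul, Complex.ofReal_cpow h4]
    push_cast
    ring_nf
  rw [← integral_rpow_mul_one_sub_rpow (by norm_num) hs]
  refine tendsto_nhds_unique (hleft.congr' heq) ?_
  exact (Complex.continuous_ofReal.tendsto _).comp (hright.const_mul 2)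

theorem integral_sin_rpow_mul_cos {s : ℝ} (hs : 0 < s) :
    ∫ θ in Ioo 0 (π / 3), Real.sin (3 * θ) ^ (s - 1) * Real.cos (3 * s * θ) =
      2 ^ (1 - s) / 3 * Real.cos (π * s / 2) *
        (Real.Gamma (1 / 2) * Real.Gamma s / Real.Gamma (1 / 2 + s)) := by
  have hpi : -π ≤ π := by linarith [Real.pi_pos]
  have h := integral_two_mul_cos_rpow_mul_exp hs
  have hi := integrableOn_two_mul_cos_rpow_mul_exp hs
  have h1 := congrArg (fun z : ℂ => (z * Complex.exp (π * s / 2 * Complex.I)).re) h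
  rw [← integral_mul_const, ← Complex.reCLM_apply, ← Complex.reCLM.integral_comp_comm
    (hi.mul_const _), Complex.re_ofReal_mul,
    show (π : ℂ) * s / 2 = ((π * s / 2 : ℝ) : ℂ) by push_cast; rfl,
    Complex.exp_ofReal_mul_I_re, ← integral_Ioc_eq_integral_Ioo,
    ← intervalIntegral.integral_of_le hpi] at h1
  have hcv := intervalIntegral.integral_comp_mul_sub (a := 0) (b := π / 3) (c := 6)
    (fun ψ : ℝ => Complex.reCLM ((((2 * Real.cos (ψ / 2)) ^ (s - 1) : ℝ) : ℂ) *
      Complex.exp (s * ψ / 2 * Complex.I) * Complex.exp ((π * s / 2 : ℝ) * Complex.I)))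
    (by norm_num) π
  rw [show (6 : ℝ) * 0 - π = -π by ring, show 6 * (π / 3) - π = π by ring, h1,
    intervalIntegral.integral_of_le (by positivity), integral_Ioc_eq_integral_Ioo] at hcv
  have hrw : ∀ θ ∈ Ioo 0 (π / 3), Real.sin (3 * θ) ^ (s - 1) * Real.cos (3 * s * θ) =
      2 ^ (1 - s) * Complex.reCLM ((((2 * Real.cos ((6 * θ - π) / 2)) ^ (s - 1) : ℝ) : ℂ) *
      Complex.exp (s * ((6 * θ - π : ℝ) : ℂ) / 2 * Complex.I) *
        Complex.exp ((π * s / 2 : ℝ) * Complex.I)) := fun θ hθ => by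
    have hsin : 0 ≤ Real.sin (3 * θ) :=
      Real.sin_nonneg_of_nonneg_of_le_pi (by linarith [hθ.1]) (by linarith [hθ.2])
    rw [mul_assoc (Complex.ofReal _), ← Complex.exp_add, ← add_mul,
      show (s : ℂ) * ((6 * θ - π : ℝ) : ℂ) / 2 + (π * s / 2 : ℝ) = ((3 * s * θ : ℝ) : ℂ) by
        push_cast; ring,
      Complex.reCLM_apply, Complex.re_ofReal_mul, Complex.exp_ofReal_mul_I_re,
      show (6 * θ - π) / 2 = 3 * θ - π / 2 by ring, Real.cos_sub_pi_div_two,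
      Real.mul_rpow two_pos.le hsin, ← mul_assoc, ← mul_assoc, ← Real.rpow_add two_pos]
    simp
  rw [setIntegral_congr_fun measurableSet_Ioo hrw, integral_const_mul, hcv]
  simp only [smul_eq_mul]
  ring

theorem Gamma_add_natCast_eq_ascPochhammer_mul {x : ℝ} (hx : 0 < x) (k : ℕ) :
    Real.Gamma (x + k) = (ascPochhammer ℝ k).eval x * Real.Gamma x := by
  induction k with
  | zero => simp
  | succ k ih =>
    rw [Nat.cast_succ, ← add_assoc, Real.Gamma_add_one (by positivity), ih,
      ascPochhammer_succ_eval]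
    ring

/-- Euler's integral representation of a series with bounded coefficients `c` twisted by
`(u)_k / (u + v)_k`. -/
theorem tsum_ascPochhammer_ratio_mul {c : ℕ → ℝ} {M : ℝ} (hc : ∀ k, |c k| ≤ M) {u v x : ℝ}
    (hu : 0 < u) (hv : 0 < v) (hx0 : 0 ≤ x) (hx1 : x < 1) :
    Real.Gamma u * Real.Gamma v / Real.Gamma (u + v) *
        ∑' k, (ascPochhammer ℝ k).eval u / (ascPochhammer ℝ k).eval (u + v) * c k * x ^ k =
      ∫ t in Ioo (0 : ℝ) 1, t ^ (u - 1) * (1 - t) ^ (v - 1) * ∑' k, c k * (x * t) ^ k := by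
  have huk : ∀ k : ℕ, 0 < u + k := fun k => by positivity
  have hval : ∀ k : ℕ, ∫ t in Ioo (0 : ℝ) 1, t ^ (u + k - 1) * (1 - t) ^ (v - 1) =
      Real.Gamma u * Real.Gamma v / Real.Gamma (u + v) *
        ((ascPochhammer ℝ k).eval u / (ascPochhammer ℝ k).eval (u + v)) := fun k => by
    rw [integral_rpow_mul_one_sub_rpow (huk k) hv, add_right_comm,
      Gamma_add_natCast_eq_ascPochhammer_mul hu,
      Gamma_add_natCast_eq_ascPochhammer_mul (add_pos hu hv)]
    ring
  have hle : ∀ k : ℕ, ∫ t in Ioo (0 : ℝ) 1, t ^ (u + k - 1) * (1 - t) ^ (v - 1) ≤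
      ∫ t in Ioo (0 : ℝ) 1, t ^ (u - 1) * (1 - t) ^ (v - 1) := fun k => by
    refine setIntegral_mono_on (integrableOn_rpow_mul_one_sub_rpow (huk k) hv)
      (integrableOn_rpow_mul_one_sub_rpow hu hv) measurableSet_Ioo fun t ht => ?_
    refine mul_le_mul_of_nonneg_right ?_ (Real.rpow_nonneg (by linarith [ht.2]) _)
    refine Real.rpow_le_rpow_of_exponent_ge ht.1 ht.2.le ?_
    have : (0 : ℝ) ≤ k := by positivity
    linarith
  have h := hasSum_integral_of_summable_integral_norm (μ := volume.restrict (Ioo (0 : ℝ) 1))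
    (F := fun (k : ℕ) (t : ℝ) => c k * x ^ k * (t ^ (u + k - 1) * (1 - t) ^ (v - 1)))
    (fun k => (integrableOn_rpow_mul_one_sub_rpow (huk k) hv).const_mul _) ?_
  · rw [← tsum_mul_left]
    refine Eq.trans (tsum_congr fun k => ?_) (h.tsum_eq.trans ?_)
    · rw [integral_const_mul, hval]
      ring
    · refine setIntegral_congr_fun measurableSet_Ioo fun t ht => ?_
      rw [← tsum_mul_left]
      refine tsum_congr fun k => ?_
      rw [add_sub_right_comm, Real.rpow_add ht.1, Real.rpow_natCast, mul_pow]
      ring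
  · have hnorm : ∀ k : ℕ, ∫ t in Ioo (0 : ℝ) 1,
        ‖c k * x ^ k * (t ^ (u + k - 1) * (1 - t) ^ (v - 1))‖ =
        |c k| * x ^ k * ∫ t in Ioo (0 : ℝ) 1, t ^ (u + k - 1) * (1 - t) ^ (v - 1) := fun k => by
      rw [← integral_const_mul]
      refine setIntegral_congr_fun measurableSet_Ioo fun t ht => ?_
      have h1 : 0 ≤ t ^ (u + k - 1) * (1 - t) ^ (v - 1) :=
        mul_nonneg (Real.rpow_nonneg ht.1.le _) (Real.rpow_nonneg (by linarith [ht.2]) _)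
      rw [norm_mul, norm_mul, Real.norm_of_nonneg h1, Real.norm_eq_abs,
        Real.norm_of_nonneg (pow_nonneg hx0 k)]
    have hnn : ∀ k : ℕ, 0 ≤ ∫ t in Ioo (0 : ℝ) 1, t ^ (u + k - 1) * (1 - t) ^ (v - 1) :=
      fun k => setIntegral_nonneg measurableSet_Ioo fun t ht =>
        mul_nonneg (Real.rpow_nonneg ht.1.le _) (Real.rpow_nonneg (by linarith [ht.2]) _)
    simp only [hnorm]
    refine Summable.of_nonneg_of_le (fun k => mul_nonneg (by positivity) (hnn k)) (fun k => ?_)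
      (((summable_geometric_of_lt_one hx0 hx1).mul_left M).mul_right
        (∫ t in Ioo (0 : ℝ) 1, t ^ (u - 1) * (1 - t) ^ (v - 1)))
    have hM : 0 ≤ M := (abs_nonneg _).trans (hc 0)
    exact mul_le_mul (mul_le_mul_of_nonneg_right (hc k) (pow_nonneg hx0 k)) (hle k) (hnn k)
      (by positivity)

theorem sin_three_mul_eq_sin_mul (θ : ℝ) :
    Real.sin (3 * θ) = 3 * Real.sin θ * (1 - 4 / 3 * Real.sin θ ^ 2) := by
  rw [Real.sin_three_mul]
  ring

theorem image_sin_sq_Ioo :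
    (fun θ => 4 / 3 * Real.sin θ ^ 2) '' Ioo 0 (π / 3) = Ioo (0 : ℝ) 1 := by
  have hπ := Real.pi_pos
  ext t
  constructor
  · rintro ⟨θ, hθ, rfl⟩
    have h1 : 0 < Real.sin θ := Real.sin_pos_of_pos_of_lt_pi hθ.1 (by linarith [hθ.2])
    have h3 : 0 < Real.sin (3 * θ) :=
      Real.sin_pos_of_pos_of_lt_pi (by linarith [hθ.1]) (by linarith [hθ.2])
    rw [sin_three_mul_eq_sin_mul] at h3
    have := pos_of_mul_pos_right h3 (by positivity)
    exact ⟨by positivity, by simpa using this⟩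
  · intro ht
    have hc : ContinuousOn (fun θ => 4 / 3 * Real.sin θ ^ 2) (Icc 0 (π / 3)) := by fun_prop
    have h := intermediate_value_Ioo (by positivity : (0 : ℝ) ≤ π / 3) hc
    refine h ?_
    simp only [Real.sin_zero, Real.sin_pi_div_three, div_pow]
    rw [Real.sq_sqrt (by norm_num)]
    norm_num
    exact ht

theorem injOn_sin_sq_Ioo : InjOn (fun θ => 4 / 3 * Real.sin θ ^ 2) (Ioo 0 (π / 3)) := by
  have hπ := Real.pi_pos
  intro θ hθ η hη h
  have h1 : 0 < Real.sin θ := Real.sin_pos_of_pos_of_lt_pi hθ.1 (by linarith [hθ.2])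
  have h2 : 0 < Real.sin η := Real.sin_pos_of_pos_of_lt_pi hη.1 (by linarith [hη.2])
  have h3 : Real.sin θ = Real.sin η :=
    (sq_eq_sq₀ h1.le h2.le).1 (mul_left_cancel₀ (by norm_num) h)
  exact Real.injOn_sin ⟨by linarith [hθ.1], by linarith [hθ.2]⟩
    ⟨by linarith [hη.1], by linarith [hη.2]⟩ h3

/-- The substitution `t = (4/3) sin² θ`, under which `1 - t = sin (3θ) / (3 sin θ)`. -/
theorem integral_beta_halfCoeff_eq {a : ℝ} :
    ∫ t in Ioo (0 : ℝ) 1, t ^ (a - 1) * (1 - t) ^ (2 * a - 1) *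
        ∑' k, halfCoeff (3 * a) k * (3 / 4 * t) ^ k =
      2 * 4 ^ a * 3 ^ (1 - 3 * a) *
        ∫ θ in Ioo 0 (π / 3), Real.sin (3 * θ) ^ (2 * a - 1) * Real.cos (3 * (2 * a) * θ) := by
  have hπ := Real.pi_pos
  rw [← image_sin_sq_Ioo, integral_image_eq_integral_abs_deriv_smul measurableSet_Ioo
    (f' := fun θ => 4 / 3 * (2 * Real.sin θ * Real.cos θ))
    (fun θ _ => HasDerivAt.hasDerivWithinAt ?_) injOn_sin_sq_Ioo, ← integral_const_mul]
  · refine setIntegral_congr_fun measurableSet_Ioo fun θ hθ => ?_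
    have h1 : 0 < Real.sin θ := Real.sin_pos_of_pos_of_lt_pi hθ.1 (by linarith [hθ.2])
    have h2 : 0 < Real.cos θ :=
      Real.cos_pos_of_mem_Ioo ⟨by linarith [hθ.1], by linarith [hθ.2]⟩
    have h3 : 0 < Real.sin (3 * θ) :=
      Real.sin_pos_of_pos_of_lt_pi (by linarith [hθ.1]) (by linarith [hθ.2])
    have hser := cos_mul_tsum_halfCoeff (3 * a) (θ := θ)
      ⟨by linarith [hθ.1], by linarith [hθ.2]⟩
    have hsub : 1 - 4 / 3 * Real.sin θ ^ 2 = Real.sin (3 * θ) / (3 * Real.sin θ) := by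
      rw [sin_three_mul_eq_sin_mul]
      field_simp
    have hz : 3 / 4 * (4 / 3 * Real.sin θ ^ 2) = Real.sin θ ^ 2 := by ring
    have hpow : (4 / 3 * Real.sin θ ^ 2) ^ (a - 1) * (4 / 3 * (2 * Real.sin θ)) =
        2 * 4 ^ a * 3 ^ (-a) * Real.sin θ ^ (2 * a - 1) := by
      rw [Real.mul_rpow (by norm_num) (by positivity), Real.div_rpow (by norm_num) (by norm_num),
        ← Real.rpow_natCast, ← Real.rpow_mul h1.le, Real.rpow_sub_one (by norm_num),
        Real.rpow_sub_one (by norm_num), Real.rpow_neg (by norm_num),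
        show ((2 : ℕ) : ℝ) * (a - 1) = 2 * a - 1 - 1 by push_cast; ring,
        Real.rpow_sub_one h1.ne']
      field_simp
    have hpow' : (Real.sin (3 * θ) / (3 * Real.sin θ)) ^ (2 * a - 1) =
        Real.sin (3 * θ) ^ (2 * a - 1) / (3 ^ (2 * a - 1) * Real.sin θ ^ (2 * a - 1)) := by
      rw [Real.div_rpow h3.le (by positivity), Real.mul_rpow (by norm_num) h1.le]
    have h33 : (3 : ℝ) ^ (1 - 3 * a) * 3 ^ (2 * a - 1) = 3 ^ (-a) := by
      rw [← Real.rpow_add (by norm_num)]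
      ring_nf
    have hp3 : (3 : ℝ) ^ (2 * a - 1) ≠ 0 := by positivity
    have hps : Real.sin θ ^ (2 * a - 1) ≠ 0 := by positivity
    rw [show 2 * (3 * a) * θ = 3 * (2 * a) * θ by ring] at hser
    simp only [smul_eq_mul]
    rw [abs_of_pos (by positivity), hz, hsub, hpow', ← hser]
    set S := ∑' k, halfCoeff (3 * a) k * (Real.sin θ ^ 2) ^ k
    calc _ = ((4 / 3 * Real.sin θ ^ 2) ^ (a - 1) * (4 / 3 * (2 * Real.sin θ))) *
          (Real.sin (3 * θ) ^ (2 * a - 1) / (3 ^ (2 * a - 1) * Real.sin θ ^ (2 * a - 1))) *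
          (Real.cos θ * S) := by ring
      _ = _ := by
        rw [hpow, ← h33]
        field_simp
  · simpa using ((Real.hasDerivAt_sin θ).fun_pow 2).const_mul (4 / 3)

theorem hypergeometric_3F2_special_value_b (a : ℝ) (ha : 1 / 6 ≤ a) :
    ∑' k : ℕ, (ascPochhammer ℝ k).eval a * (ascPochhammer ℝ k).eval (1 / 2 - 3 * a) *
        (ascPochhammer ℝ k).eval (1 / 2 + 3 * a) /
        ((ascPochhammer ℝ k).eval (3 * a) * (ascPochhammer ℝ k).eval (1 / 2 : ℝ) *
          (Nat.factorial k : ℝ)) * (3 / 4 : ℝ) ^ k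
      = 4 * Real.sqrt π * Real.Gamma (3 * a) * Real.cos (π * a) /
          ((3 : ℝ) ^ (3 * a) * Real.Gamma (2 * a + 1 / 2) * Real.Gamma a) := by
  have ha0 : 0 < a := by linarith
  obtain ⟨M, hM⟩ := exists_abs_halfCoeff_le (3 * a)
  have h := tsum_ascPochhammer_ratio_mul hM (x := 3 / 4) ha0 (mul_pos two_pos ha0)
    (by norm_num) (by norm_num)
  rw [integral_beta_halfCoeff_eq, integral_sin_rpow_mul_cos (mul_pos two_pos ha0),
    show a + 2 * a = 3 * a by ring, show π * (2 * a) / 2 = π * a by ring,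
    Real.Gamma_one_half_eq, add_comm (1 / 2 : ℝ) (2 * a)] at h
  have hG1 := (Real.Gamma_pos_of_pos ha0).ne'
  have hG2 := (Real.Gamma_pos_of_pos (mul_pos two_pos ha0)).ne'
  have hG3 := (Real.Gamma_pos_of_pos (show 0 < 3 * a by linarith)).ne'
  have hG4 := (Real.Gamma_pos_of_pos (show 0 < 2 * a + 1 / 2 by linarith)).ne'
  have h3 : (3 : ℝ) ^ (1 - 3 * a) = 3 / 3 ^ (3 * a) := by
    rw [Real.rpow_sub (by norm_num), Real.rpow_one]
  have h4 : (4 : ℝ) ^ a * 2 ^ (1 - 2 * a) = 2 := by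
    rw [show (4 : ℝ) = 2 ^ (2 : ℝ) by norm_num, ← Real.rpow_mul (by norm_num),
      ← Real.rpow_add (by norm_num)]
    norm_num
  have hterm : ∀ k : ℕ, (ascPochhammer ℝ k).eval a * (ascPochhammer ℝ k).eval (1 / 2 - 3 * a) *
        (ascPochhammer ℝ k).eval (1 / 2 + 3 * a) /
        ((ascPochhammer ℝ k).eval (3 * a) * (ascPochhammer ℝ k).eval (1 / 2 : ℝ) *
          (Nat.factorial k : ℝ)) * (3 / 4 : ℝ) ^ k =
      (ascPochhammer ℝ k).eval a / (ascPochhammer ℝ k).eval (3 * a) * halfCoeff (3 * a) k *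
        (3 / 4) ^ k := fun k => by
    rw [halfCoeff, div_mul_div_comm, mul_assoc, mul_assoc (eval (3 * a) _)]
  rw [tsum_congr hterm]
  have hB : Real.Gamma a * Real.Gamma (2 * a) / Real.Gamma (3 * a) ≠ 0 := by positivity
  refine mul_left_cancel₀ hB (h.trans ?_)
  rw [h3, mul_comm π a]
  have h3pos : (3 : ℝ) ^ (3 * a) ≠ 0 := by positivity
  field_simp
  linear_combination 2 * Real.cos (a * π) * h4
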